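/- arXiv:2105.05677 — 2 statements merged into one kernel-verified Lean document; each statement's English description precedes it below -/
import Mathlib

section
/- Let (X,d) be a compact metric space, let μ be a finite (nonnegative) Borel measure on X, and let J be a finite signed Borel measure on X. If J is not absolutely continuous with respect to μ, i.e. there exists a Borel set A ⊆ X with μ(A) = 0 and J(A) ≠ 0, then B₂(μ,J) = +∞. -/
open MeasureTheory

/-- Integration of a real-valued function against a finite signed Borel measure,
defined as the difference of the integrals against the positive and negative
parts of its Jordan decomposition. -/
noncomputable def signedIntegral {X : Type*} [MeasurableSpace X]
    (μ : SignedMeasure X) (f : X → ℝ) : ℝ :=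
  ∫ x, f x ∂μ.toJordanDecomposition.posPart - ∫ x, f x ∂μ.toJordanDecomposition.negPart

/-- The Benamou–Brenier functional: the supremum, over all pairs of continuous
functions `a b : X → ℝ` with `a x + (b x)²/2 ≤ 0` everywhere, of
`∫ a dμ + ∫ b dJ`, computed in the extended reals. -/
noncomputable def BB2 {X : Type*} [MeasurableSpace X] [TopologicalSpace X]
    (μ J : SignedMeasure X) : EReal :=
  ⨆ p : {p : C(X, ℝ) × C(X, ℝ) // ∀ x, p.1 x + (p.2 x) ^ 2 / 2 ≤ 0},
    ((signedIntegral μ p.1.1 + signedIntegral J p.1.2 : ℝ) : EReal)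

/-- Against a finite nonnegative measure, `signedIntegral` is the Bochner integral. -/
theorem signedIntegral_toSignedMeasure {X : Type*} [MeasurableSpace X]
    (μ : Measure X) [IsFiniteMeasure μ] (f : X → ℝ) :
    signedIntegral μ.toSignedMeasure f = ∫ x, f x ∂μ := by
  have h : μ.toSignedMeasure.toJordanDecomposition = ⟨μ, 0, Measure.MutuallySingular.zero_right⟩ :=
    SignedMeasure.toJordanDecomposition_eq (by simp [JordanDecomposition.toSignedMeasure])
  simp [signedIntegral, h]

theorem signedMeasure_apply_eq_sub {X : Type*} [MeasurableSpace X]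
    (J : SignedMeasure X) {A : Set X} (hA : MeasurableSet A) :
    J A = J.toJordanDecomposition.posPart.real A - J.toJordanDecomposition.negPart.real A := by
  conv_lhs => rw [← J.toSignedMeasure_toJordanDecomposition]
  rw [JordanDecomposition.toSignedMeasure, Measure.toSignedMeasure_sub_apply hA]

/-- A consequence of Young's inequality `|t h| ≤ (t² h² + 1) / 2`. -/
theorem abs_mul_integral_sub_le {X : Type*} [MeasurableSpace X] (ν : Measure X)
    [IsFiniteMeasure ν] {f g : X → ℝ} (hf : Integrable f ν) (hg : Integrable g ν)
    (hfg : Integrable (fun x ↦ (f x - g x) ^ 2) ν) (t : ℝ) :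
    |t * (∫ x, f x ∂ν - ∫ x, g x ∂ν)| ≤
      (t ^ 2 * ∫ x, (f x - g x) ^ 2 ∂ν + ν.real Set.univ) / 2 := by
  have hint : Integrable (fun x ↦ (t ^ 2 * (f x - g x) ^ 2 + 1) / 2) ν :=
    ((hfg.const_mul _).add (integrable_const 1)).div_const 2
  rw [← integral_sub hf hg, ← integral_const_mul]
  calc |∫ x, t * (f x - g x) ∂ν| ≤ ∫ x, |t * (f x - g x)| ∂ν := abs_integral_le_integral_abs
    _ ≤ ∫ x, (t ^ 2 * (f x - g x) ^ 2 + 1) / 2 ∂ν := by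
      refine integral_mono ((hf.sub hg).const_mul t).abs hint fun x ↦ abs_le.2 ⟨?_, ?_⟩
      · nlinarith [sq_nonneg (t * (f x - g x) + 1)]
      · nlinarith [sq_nonneg (t * (f x - g x) - 1)]
    _ = _ := by
      rw [integral_div, integral_add (hfg.const_mul _) (integrable_const 1), integral_const_mul]
      simp

/-- Evaluating the Benamou–Brenier functional on the pair `(-b² / 2, b)`. -/
theorem le_BB2_toSignedMeasure {X : Type*} [MeasurableSpace X] [TopologicalSpace X]
    (μ : Measure X) [IsFiniteMeasure μ] (J : SignedMeasure X) (b : C(X, ℝ)) :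
    ((signedIntegral J b - (∫ x, b x ^ 2 ∂μ) / 2 : ℝ) : EReal) ≤ BB2 μ.toSignedMeasure J := by
  refine le_iSup_of_le ⟨(⟨fun x ↦ -(b x ^ 2 / 2), by fun_prop⟩, b), fun x ↦ ?_⟩ ?_
  · simp
  · refine EReal.coe_le_coe_iff.2 (le_of_eq ?_)
    rw [signedIntegral_toSignedMeasure]
    simp only [ContinuousMap.coe_mk, integral_neg, integral_div]
    ring

/-- If `μ` is a finite nonnegative Borel measure and the finite
signed Borel measure `J` is not absolutely continuous with respect to `μ`
(there is a Borel set `A` with `μ A = 0` and `J A ≠ 0`), then `B₂(μ,J) = +∞`. -/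
theorem BB2_eq_top_of_not_absolutelyContinuous {X : Type*} [MetricSpace X] [CompactSpace X]
    [MeasurableSpace X] [BorelSpace X]
    (μ : Measure X) [IsFiniteMeasure μ] (J : SignedMeasure X)
    (A : Set X) (hA : MeasurableSet A) (hμA : μ A = 0) (hJA : J A ≠ 0) :
    BB2 μ.toSignedMeasure J = ⊤ := by
  have hJ := signedMeasure_apply_eq_sub J hA
  set P := J.toJordanDecomposition.posPart with hP
  set N := J.toJordanDecomposition.negPart with hN
  refine (EReal.eq_top_iff_forall_lt _).2 fun R ↦ ?_
  obtain ⟨t, ht⟩ : ∃ t : ℝ, t * J A = R + (P.real Set.univ + N.real Set.univ) / 2 + 2 :=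
    ⟨_, div_mul_cancel₀ _ hJA⟩
  set f : X → ℝ := A.indicator 1 with hf
  have hfint (ν : Measure X) [IsFiniteMeasure ν] : Integrable f ν :=
    (integrable_const (1 : ℝ)).indicator hA
  have hfA (ν : Measure X) [IsFiniteMeasure ν] : ∫ x, f x ∂ν = ν.real A :=
    integral_indicator_one hA
  have hfL : MemLp f (ENNReal.ofReal 2) (P + N + μ) := (memLp_const (1 : ℝ)).indicator hA
  have htpos : 0 < t ^ 2 + 1 := by positivity
  obtain ⟨g, hg, hgL⟩ :=
    hfL.exists_boundedContinuous_integral_rpow_sub_le two_pos (inv_pos.2 htpos)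
  have hgint (ν : Measure X) [IsFiniteMeasure ν] : Integrable g ν := g.integrable ν
  have hsq : Integrable (fun x ↦ (f x - g x) ^ 2) (P + N + μ) := by
    have h := hfL.sub hgL
    rw [ENNReal.ofReal_ofNat] at h
    exact h.integrable_sq
  have hsqPN := hsq.left_of_add_measure
  have hsqP := hsqPN.left_of_add_measure
  have hsqN := hsqPN.right_of_add_measure
  have hsqμ := hsq.right_of_add_measure
  simp only [Real.rpow_two, Real.norm_eq_abs, sq_abs] at hg
  rw [integral_add_measure hsqPN hsqμ, integral_add_measure hsqP hsqN] at hg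
  have hμ : ∫ x, (f x - g x) ^ 2 ∂μ = ∫ x, g x ^ 2 ∂μ := by
    refine integral_congr_ae ?_
    filter_upwards [measure_eq_zero_iff_ae_notMem.1 hμA] with x hx
    simp [hf, hx]
  rw [hμ] at hg
  have hgt : t ^ 2 * (∫ x, (f x - g x) ^ 2 ∂P + ∫ x, (f x - g x) ^ 2 ∂N + ∫ x, g x ^ 2 ∂μ) ≤ 1 :=
    calc _ ≤ t ^ 2 * (t ^ 2 + 1)⁻¹ := by gcongr
      _ ≤ 1 := by rw [← div_eq_mul_inv, div_le_one htpos]; linarith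
  have hPb := abs_le.1 (abs_mul_integral_sub_le P (hfint P) (hgint P) hsqP t)
  have hNb := abs_le.1 (abs_mul_integral_sub_le N (hfint N) (hgint N) hsqN t)
  rw [hfA] at hPb hNb
  rw [hJ] at ht
  refine lt_of_lt_of_le (EReal.coe_lt_coe_iff.2 ?_)
    (le_BB2_toSignedMeasure μ J (t • g.toContinuousMap))
  simp only [signedIntegral, ← hP, ← hN, ContinuousMap.smul_apply,
    BoundedContinuousFunction.coe_toContinuousMap, smul_eq_mul, mul_pow, integral_const_mul]
  linarith [hPb.2, hNb.1]
end

section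
/- Let (X,d) be a nonempty metric space, let L ≥ 0, let f : X → ℝ be Lipschitz with constant L, and let t > 0. Then for every non-isolated point x ∈ X the local Lipschitz constant of Q_t f satisfies lip(Q_t f)(x) := limsup_{y→x} |Q_t f(y) − Q_t f(x)|/d(x,y) ≤ 2L. -/
/-- The Hopf–Lax semigroup: `Q_t f (x) = inf_{y ∈ X} (f y + d(x,y)²/(2t))`. -/
noncomputable def hopfLax {X : Type*} [MetricSpace X] (t : ℝ) (f : X → ℝ) (x : X) : ℝ :=
  ⨅ y : X, (f y + dist x y ^ 2 / (2 * t))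

open Filter Topology

/-- The infimum defining `hopfLax t f x` is over a family bounded below when `f` is Lipschitz. -/
theorem bddBelow_range_hopfLax {X : Type*} [MetricSpace X] {L t : ℝ} (ht : 0 < t) {f : X → ℝ}
    (hf : ∀ x y, |f x - f y| ≤ L * dist x y) (x : X) :
    BddBelow (Set.range fun y => f y + dist x y ^ 2 / (2 * t)) := by
  refine ⟨f x - t * L ^ 2 / 2, ?_⟩
  rintro _ ⟨y, rfl⟩
  have hxy := (abs_le.1 (hf x y)).2
  have hsq : L * dist x y - t * L ^ 2 / 2 ≤ dist x y ^ 2 / (2 * t) := by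
    rw [le_div_iff₀ (by positivity)]
    nlinarith [sq_nonneg (dist x y - t * L)]
  dsimp only
  linarith

theorem hopfLax_le_add {X : Type*} [MetricSpace X] {L t : ℝ} (hL : 0 ≤ L) (ht : 0 < t)
    {f : X → ℝ} (hf : ∀ x y, |f x - f y| ≤ L * dist x y) (p q : X) :
    hopfLax t f q ≤ hopfLax t f p + (2 * L * dist q p + dist q p ^ 2 / (2 * t)) := by
  have near (y : X) (hy : dist p y ≤ 2 * t * L) : hopfLax t f q ≤
      f y + dist p y ^ 2 / (2 * t) + (2 * L * dist q p + dist q p ^ 2 / (2 * t)) := by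
    have hle : hopfLax t f q ≤ f y + dist q y ^ 2 / (2 * t) :=
      ciInf_le (bddBelow_range_hopfLax ht hf q) y
    have hsq : dist q y ^ 2 ≤
        dist p y ^ 2 + 2 * L * dist q p * (2 * t) + dist q p ^ 2 := by
      nlinarith [pow_le_pow_left₀ dist_nonneg (dist_triangle q p y) 2,
        mul_le_mul_of_nonneg_left hy (dist_nonneg (x := q) (y := p))]
    have hdiv := div_le_div_of_nonneg_right hsq (by positivity : 0 ≤ 2 * t)
    rw [add_div, add_div, mul_div_cancel_right₀ _ (by positivity)] at hdiv
    linarith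
  have : Nonempty X := ⟨p⟩
  rw [← sub_le_iff_le_add]
  refine le_ciInf fun y => ?_
  rcases le_total (dist p y) (2 * t * L) with hy | hy
  · linarith [near y hy]
  · have hp := near p (by rw [dist_self]; positivity)
    rw [dist_self] at hp
    have hfar : L * dist p y ≤ dist p y ^ 2 / (2 * t) := by
      rw [le_div_iff₀ (by positivity)]
      nlinarith [mul_le_mul_of_nonneg_left hy (dist_nonneg (x := p) (y := y))]
    have hpy := (abs_le.1 (hf p y)).2
    norm_num at hp
    linarith

theorem abs_hopfLax_sub_le {X : Type*} [MetricSpace X] {L t : ℝ} (hL : 0 ≤ L) (ht : 0 < t)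
    {f : X → ℝ} (hf : ∀ x y, |f x - f y| ≤ L * dist x y) (p q : X) :
    |hopfLax t f p - hopfLax t f q| ≤ 2 * L * dist q p + dist q p ^ 2 / (2 * t) := by
  have hqp := hopfLax_le_add hL ht hf p q
  have hpq := hopfLax_le_add hL ht hf q p
  rw [dist_comm p q] at hpq
  exact abs_le.2 ⟨by linarith, by linarith⟩


/-- For an `L`-Lipschitz function `f` and `t > 0`, at every
non-isolated point `x` the local Lipschitz constant of `Q_t f`, i.e.
`limsup_{y→x} |Q_t f (y) − Q_t f (x)| / d(x,y)`, is at most `2L`. -/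
theorem hopfLax_localLipschitz_le {X : Type*} [MetricSpace X] [Nonempty X]
    (L t : ℝ) (hL : 0 ≤ L) (ht : 0 < t) (f : X → ℝ)
    (hf : ∀ x y, |f x - f y| ≤ L * dist x y) (x : X)
    (hx : (𝓝[≠] x).NeBot) :
    Filter.limsup (fun y => |hopfLax t f y - hopfLax t f x| / dist x y) (𝓝[≠] x)
      ≤ 2 * L := by
  have hlim : Tendsto (fun y => 2 * L + dist x y / (2 * t)) (𝓝[≠] x) (𝓝 (2 * L)) := by
    have hcont : Continuous fun y => 2 * L + dist x y / (2 * t) := by fun_prop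
    simpa using (hcont.tendsto x).mono_left nhdsWithin_le_nhds
  rw [← hlim.limsup_eq]
  refine limsup_le_limsup ?_ ?_ hlim.isBoundedUnder_le
  · filter_upwards [self_mem_nhdsWithin] with y hy
    have hpos : 0 < dist x y := dist_pos.2 (Ne.symm hy)
    rw [div_le_iff₀ hpos]
    have hquot : 2 * L * dist x y + dist x y ^ 2 / (2 * t) =
        (2 * L + dist x y / (2 * t)) * dist x y := by ring
    exact (abs_hopfLax_sub_le hL ht hf y x).trans_eq hquot
  · exact IsCoboundedUnder.of_frequently_ge (a := 0)
      (Eventually.of_forall fun y => by positivity).frequently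
end
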